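/- A set X ⊆ ℝ is meager-additive (i.e., X + M is meager for every meager M ⊆ ℝ) if and only if X has sharp measure zero with respect to the Euclidean metric. -/

import Mathlib

open MeasureTheory Set Filter Pointwise
open scoped ENNReal NNReal Topology

/-- A gauge: a nondecreasing, right-continuous function `h : [0,∞) → [0,∞]` with `h 0 = 0`
and `h r > 0` for `r > 0`. -/
def IsGauge (h : ℝ≥0∞ → ℝ≥0∞) : Prop :=
  Monotone h ∧ (∀ r : ℝ≥0∞, Filter.Tendsto h (nhdsWithin r (Set.Ioi r)) (nhds (h r))) ∧
    h 0 = 0 ∧ ∀ r : ℝ≥0∞, 0 < r → 0 < h r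

/-- `X` has strong measure zero: for every sequence of positive reals `ε n` there is a
countable cover `U n` of `X` with `diam (U n) ≤ ε n` for all `n`. -/
def HasSMZ (X : Type*) [MetricSpace X] : Prop :=
  ∀ ε : ℕ → ℝ, (∀ n, 0 < ε n) →
    ∃ U : ℕ → Set X, (∀ x : X, ∃ n, x ∈ U n) ∧
      ∀ n, EMetric.diam (U n) ≤ ENNReal.ofReal (ε n)

/-- `⟨U n⟩` is a γ-groupable cover of `E`: there is a strictly increasing sequence
`0 = k 0 < k 1 < ⋯` such that every `x ∈ E` belongs to `⋃_{k j ≤ n < k (j+1)} U n`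
for all but finitely many `j`. -/
def IsGammaGroupable {X : Type*} (U : ℕ → Set X) (E : Set X) : Prop :=
  ∃ k : ℕ → ℕ, k 0 = 0 ∧ StrictMono k ∧
    ∀ x ∈ E, ∀ᶠ j in Filter.atTop, ∃ n, k j ≤ n ∧ n < k (j + 1) ∧ x ∈ U n

/-- A set `E` in a metric space has sharp measure zero: for every sequence of positive reals
`ε n` it admits a γ-groupable cover `U n` with `diam (U n) ≤ ε n` for all `n`. -/
def IsSSMZ {X : Type*} [MetricSpace X] (E : Set X) : Prop :=
  ∀ ε : ℕ → ℝ, (∀ n, 0 < ε n) →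
    ∃ U : ℕ → Set X, IsGammaGroupable U E ∧
      ∀ n, EMetric.diam (U n) ≤ ENNReal.ofReal (ε n)

/-- A metric space has sharp measure zero. -/
def HasSSMZ (X : Type*) [MetricSpace X] : Prop := IsSSMZ (Set.univ : Set X)

/-- A meagre subset of `ℝ` is covered by an increasing sequence of compact meagre sets. -/
theorem IsMeagre.exists_monotone_isCompact {M : Set ℝ} (hM : IsMeagre M) :
    ∃ F : ℕ → Set ℝ, Monotone F ∧ (∀ n, IsCompact (F n)) ∧ (∀ n, IsMeagre (F n)) ∧
      M ⊆ ⋃ n, F n := by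
  obtain ⟨S, hS, hSc, hMS⟩ := isMeagre_iff_countable_union_isNowhereDense.1 hM
  obtain ⟨s, hs⟩ := (hSc.insert ∅).exists_eq_range (insert_nonempty _ _)
  have hnd : ∀ i, IsNowhereDense (s i) := by
    intro i
    have hi : s i ∈ insert ∅ S := hs ▸ mem_range_self i
    rcases hi with hi | hi
    · rw [hi]
      exact isNowhereDense_empty
    · exact hS _ hi
  refine ⟨fun n => (⋃ i ∈ Iic n, closure (s i)) ∩ Metric.closedBall 0 n, ?_, ?_, ?_, ?_⟩
  · intro m n hmn
    refine inter_subset_inter (biUnion_subset_biUnion_left (Iic_subset_Iic.2 hmn))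
      (Metric.closedBall_subset_closedBall (by exact_mod_cast hmn))
  · intro n
    exact (isCompact_closedBall _ _).inter_left
      ((finite_Iic n).isClosed_biUnion fun i _ => isClosed_closure)
  · intro n
    exact (isMeagre_biUnion (to_countable _) fun i _ => (hnd i).closure.isMeagre).inter
  · intro x hx
    obtain ⟨t, ht, hxt⟩ := hMS hx
    obtain ⟨i, rfl⟩ : t ∈ range s := hs ▸ mem_insert_of_mem _ ht
    obtain ⟨N, hN⟩ := exists_nat_ge |x|
    refine mem_iUnion.2 ⟨max i N, mem_biUnion (mem_Iic.2 (le_max_left _ _))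
      (subset_closure hxt), ?_⟩
    rw [mem_closedBall_zero_iff, Real.norm_eq_abs]
    exact hN.trans (by exact_mod_cast le_max_right _ _)

/-- Some translate of the grid `a ℤ` keeps a positive distance from a given compact meagre set. -/
theorem exists_grid_avoiding {F : Set ℝ} (hc : IsCompact F) (hm : IsMeagre F) {a : ℝ}
    (ha : 0 < a) :
    ∃ y ∈ Icc 0 a, ∃ r > 0, ∀ z ∈ F, ∀ m : ℤ, r < |z - y - a * m| := by
  set P : Set ℝ := F + (AddSubgroup.zmultiples a : Set ℝ)
  have hPc : IsClosed P :=
    IsClosed.add_left_of_isCompact (AddSubgroup.isClosed_of_discrete) hc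
  have hPm : IsMeagre P := by
    refine (isMeagre_iUnion fun m : ℤ =>
      (Homeomorph.addRight (a * m)).isInducing.isMeagre_image hm).mono ?_
    rintro _ ⟨z, hz, _, ⟨m, rfl⟩, rfl⟩
    refine mem_iUnion.2 ⟨m, z, hz, ?_⟩
    simp [mul_comm]
  obtain ⟨y, hyP, hya⟩ : (Pᶜ ∩ Ioo 0 a).Nonempty := by
    rw [inter_comm]
    exact (dense_of_mem_residual hPm).inter_open_nonempty _ isOpen_Ioo (nonempty_Ioo.2 ha)
  obtain ⟨r, hr, hball⟩ := Metric.isOpen_iff.1 hPc.isOpen_compl y hyP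
  refine ⟨y, Ioo_subset_Icc_self hya, r / 2, by positivity, fun z hz m => ?_⟩
  by_contra! h
  refine hball (a := z - a * m) ?_ ?_
  · rw [Metric.mem_ball, Real.dist_eq]
    have : z - a * m - y = z - y - a * m := by ring
    rw [this]
    linarith
  · refine ⟨z, hz, -(a * m), ⟨-m, ?_⟩, by ring⟩
    simp [mul_comm]

theorem exists_grid_near {a : ℝ} (ha : 0 < a) (y t : ℝ) :
    ∃ m : ℤ, |y + a * m - t| ≤ a / 2 := by
  refine ⟨round ((t - y) / a), ?_⟩
  have h := abs_sub_round ((t - y) / a)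
  have e : y + a * (round ((t - y) / a) : ℝ) - t
      = -(a * ((t - y) / a - round ((t - y) / a))) := by
    field_simp
    ring
  rw [e, abs_neg, abs_mul, abs_of_pos ha]
  nlinarith

/-- A real number can be prescribed approximately modulo each of the scales `a n`, provided these
decrease fast enough. -/
theorem exists_forall_near_grid {a : ℕ → ℝ} (ha : ∀ n, 0 < a n) (hh : ∀ n, a (n + 1) ≤ a n / 2)
    (c : ℕ → ℝ) : ∃ z : ℝ, ∀ n, ∃ m : ℤ, |z - c n - a n * m| ≤ a (n + 1) := by
  choose m hm using fun n t => exists_grid_near (ha n) (c n) t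
  let w : ℕ → ℝ := fun n => Nat.rec 0 (fun n t => c n + a n * m n t) n
  have hw : ∀ n, w (n + 1) = c n + a n * m n (w n) := fun n => rfl
  obtain ⟨z, hz⟩ : (⋂ n, Metric.closedBall (w n) (a n)).Nonempty := by
    refine IsCompact.nonempty_iInter_of_sequence_nonempty_isCompact_isClosed _ ?_ ?_ ?_ ?_
    · intro n
      refine Metric.closedBall_subset_closedBall' ?_
      have := hm n (w n)
      rw [← hw] at this
      rw [Real.dist_eq]
      linarith [hh n]
    · exact fun n => ⟨w n, Metric.mem_closedBall_self (ha n).le⟩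
    · exact isCompact_closedBall _ _
    · exact fun n => Metric.isClosed_closedBall
  refine ⟨z, fun n => ⟨m n (w n), ?_⟩⟩
  have h := mem_iInter.1 hz (n + 1)
  rw [Metric.mem_closedBall, Real.dist_eq, hw] at h
  convert h using 2
  ring

/-- A set of sharp measure zero is meager-additive. -/
theorem IsSSMZ.isMeagre_add {X : Set ℝ} (hX : IsSSMZ X) {M : Set ℝ} (hM : IsMeagre M) :
    IsMeagre (X + M) := by
  obtain ⟨F, hFm, hFc, hFn, hMF⟩ := hM.exists_monotone_isCompact
  have key : ∀ (n : ℕ) (a : {a : ℝ // 0 < a}), ∃ b : {b : ℝ // 0 < b}, ∃ y : ℝ,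
      b.1 ≤ a.1 / 2 ∧ ∀ z ∈ F n, ∀ m : ℤ, 2 * b.1 < |z - y - a.1 * m| := by
    rintro n ⟨a, ha⟩
    obtain ⟨y, -, r, hr, h⟩ := exists_grid_avoiding (hFc n) (hFn n) ha
    refine ⟨⟨min (r / 2) (a / 2), by positivity⟩, y, min_le_right _ _, fun z hz m => ?_⟩
    have := min_le_left (r / 2) (a / 2)
    have := h z hz m
    dsimp only
    linarith
  choose b y hb hby using key
  let D : ℕ → {a : ℝ // 0 < a} := fun n => Nat.rec ⟨1, one_pos⟩ b n
  obtain ⟨d, hd⟩ : ∃ d : ℕ → ℝ, ∀ n, d n = (D n).1 := ⟨_, fun _ => rfl⟩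
  have hd0 : ∀ n, 0 < d n := fun n => hd n ▸ (D n).2
  have hdh : ∀ n, d (n + 1) ≤ d n / 2 := fun n => by
    rw [hd, hd]
    exact hb n (D n)
  have hdF : ∀ n, ∀ z ∈ F n, ∀ m : ℤ, 2 * d (n + 1) < |z - y n (D n) - d n * m| := fun n => by
    rw [hd, hd]
    exact hby n (D n)
  have hdlim : ∀ n, d n ≤ (1 / 2) ^ n := by
    intro n
    induction n with
    | zero => simp [hd, D]
    | succ n ih =>
      rw [pow_succ]
      linarith [hdh n]
  obtain ⟨U, ⟨k, -, hk, hkU⟩, hU⟩ := hX (fun n => d (n + 1)) fun n => hd0 _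
  have step : ∀ n c, ∃ c', |c' - c| + d (n + 1) ≤ d n ∧
      ∀ u ∈ U n, ∀ f ∈ F n, d (n + 1) < |c' - (u + f)| := by
    intro n c
    rcases (U n).eq_empty_or_nonempty with h | ⟨u, hu⟩
    · exact ⟨c, by simpa using (hdh n).trans (half_le_self (hd0 n).le), by simp [h]⟩
    obtain ⟨m, hm⟩ := exists_grid_near (hd0 n) (u + y n (D n)) c
    refine ⟨_, by linarith [hdh n], fun v hv f hf => ?_⟩
    have h1 := hdF n f hf m
    have h2 : |v - u| ≤ d (n + 1) := by
      have h := (Metric.edist_le_ediam_of_mem hv hu).trans (hU n)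
      rw [edist_dist] at h
      exact (ENNReal.ofReal_le_ofReal_iff (hd0 _).le).1 h
    have h3 : f - y n (D n) - d n * m
        = -(u + y n (D n) + d n * m - (v + f)) - (v - u) := by ring
    rw [h3] at h1
    have h4 := abs_sub (-(u + y n (D n) + d n * m - (v + f))) (v - u)
    rw [abs_neg] at h4
    linarith
  have steps : ∀ p q, p ≤ q → ∀ c, ∃ c', |c' - c| + d q ≤ d p ∧
      ∀ n, p ≤ n → n < q → ∀ u ∈ U n, ∀ f ∈ F n, d q < |c' - (u + f)| := by
    intro p q hpq c
    induction q, hpq using Nat.le_induction with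
    | base => exact ⟨c, by simp, fun n h1 h2 => by omega⟩
    | succ q hpq ih =>
      obtain ⟨c₁, h1, h2⟩ := ih
      obtain ⟨c₂, h3, h4⟩ := step q c₁
      refine ⟨c₂, by linarith [abs_sub_le c₂ c₁ c], fun n hn hnq u hu f hf => ?_⟩
      rcases Nat.lt_succ_iff_lt_or_eq.1 hnq with h | rfl
      · have := h2 n hn h u hu f hf
        linarith [abs_sub_le c₁ c₂ (u + f), abs_sub_comm c₁ c₂]
      · exact h4 u hu f hf
  let T : ℕ × ℕ → Set ℝ := fun p =>
    {w | ∀ j ≥ p.2, ∃ n, k j ≤ n ∧ n < k (j + 1) ∧ w ∈ U n + F p.1}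
  have hT : ∀ p, IsNowhereDense (T p) := by
    rintro ⟨l, J⟩
    rw [IsNowhereDense, eq_empty_iff_forall_notMem]
    intro c hc
    obtain ⟨ρ, hρ, hball⟩ := Metric.isOpen_iff.1 isOpen_interior c hc
    obtain ⟨N, hN⟩ := exists_pow_lt_of_lt_one hρ (by norm_num : (1 / 2 : ℝ) < 1)
    set j := max J (max l N) with hj
    have hjk : j ≤ k j := hk.id_le j
    obtain ⟨c', h1, h2⟩ := steps (k j) (k (j + 1)) (hk (Nat.lt_succ_self j)).le c
    have hdk : d (k j) < ρ := (hdlim _).trans_lt <|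
      (pow_le_pow_of_le_one (by norm_num) (by norm_num) (by omega : N ≤ k j)).trans_lt hN
    have hc' : c' ∈ closure (T (l, J)) := by
      refine interior_subset (hball ?_)
      rw [Metric.mem_ball, Real.dist_eq]
      linarith [hd0 (k (j + 1))]
    obtain ⟨w, hw, hwc⟩ := Metric.mem_closure_iff.1 hc' _ (hd0 (k (j + 1)))
    obtain ⟨n, hn1, hn2, u, hu, f, hf, rfl⟩ := hw j (le_max_left _ _)
    have := h2 n hn1 hn2 u hu f (hFm (by omega) hf)
    rw [Real.dist_eq] at hwc
    exact lt_asymm hwc this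
  refine (isMeagre_iUnion fun p => (hT p).isMeagre).mono ?_
  rintro _ ⟨x, hx, z, hz, rfl⟩
  obtain ⟨l, hl⟩ := mem_iUnion.1 (hMF hz)
  obtain ⟨J, hJ⟩ := eventually_atTop.1 (hkU x hx)
  refine mem_iUnion.2 ⟨(l, J), fun j hj => ?_⟩
  obtain ⟨n, h1, h2, h3⟩ := hJ j hj
  exact ⟨n, h1, h2, add_mem_add h3 hl⟩

/-- The reals staying away from the grids `a k ℤ` for all but finitely many `k` form a meagre
set. -/
theorem isMeagre_eventually_far_from_grid {a : ℕ → ℝ} (ha : ∀ k, 0 < a k)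
    (hlim : Tendsto a atTop (𝓝 0)) :
    IsMeagre {z : ℝ | ∀ᶠ k in atTop, ∀ m : ℤ, a (k + 1) ≤ |z - a k * m|} := by
  have hS : ∀ N, IsNowhereDense {z : ℝ | ∀ k ≥ N, ∀ m : ℤ, a (k + 1) ≤ |z - a k * m|} := by
    intro N
    have hcl : IsClosed {z : ℝ | ∀ k ≥ N, ∀ m : ℤ, a (k + 1) ≤ |z - a k * m|} := by
      simp only [ofPred_forall]
      exact isClosed_iInter fun k => isClosed_iInter fun _ => isClosed_iInter fun m =>
        isClosed_le continuous_const (by fun_prop)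
    rw [hcl.isNowhereDense_iff, eq_empty_iff_forall_notMem]
    intro c hc
    obtain ⟨ρ, hρ, hball⟩ := Metric.isOpen_iff.1 isOpen_interior c hc
    obtain ⟨k, hk, hkN⟩ := ((hlim.eventually_lt_const hρ).and (eventually_ge_atTop N)).exists
    obtain ⟨m, hm⟩ := exists_grid_near (ha k) 0 c
    rw [zero_add] at hm
    have h : a k * m ∈ Metric.ball c ρ := by
      rw [Metric.mem_ball, Real.dist_eq]
      linarith [ha k]
    have := interior_subset (hball h) k hkN m
    simp only [sub_self, abs_zero] at this
    exact (ha _).not_ge this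
  refine (isMeagre_iUnion fun N => (hS N).isMeagre).mono fun z hz => ?_
  exact mem_iUnion.2 (eventually_atTop.1 hz)

theorem exists_mem_block {g : ℕ → ℕ} (h0 : g 0 = 0) (hg : StrictMono g) (k : ℕ) :
    ∃ n, g n ≤ k ∧ k < g (n + 1) := by
  induction k with
  | zero => exact ⟨0, h0.le, (Nat.zero_le _).trans_lt (hg (Nat.lt_succ_self 0))⟩
  | succ k ih =>
    obtain ⟨n, h1, h2⟩ := ih
    rcases (Nat.succ_le_of_lt h2).lt_or_eq with h | h
    · exact ⟨n, by omega, h⟩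
    · exact ⟨n + 1, h.ge, h.trans_lt (hg (Nat.lt_succ_self _))⟩

theorem block_unique {g : ℕ → ℕ} (hg : StrictMono g) {k m n : ℕ} (hm : g m ≤ k)
    (hm' : k < g (m + 1)) (hn : g n ≤ k) (hn' : k < g (n + 1)) : m = n := by
  have h1 := hg.lt_iff_lt.1 (hm.trans_lt hn')
  have h2 := hg.lt_iff_lt.1 (hn.trans_lt hm')
  omega

/-- Exponents `e k` and block boundaries `K k` such that the `k`-th block can index the part of a
grid of mesh `3 ^ (-e k)` near `[-k, k]`, while `3 ^ (-e (k + 1))` is small compared with all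
`ε i` up to the end of this block. -/
theorem exists_scales {ε : ℕ → ℝ} (hε : ∀ n, 0 < ε n) :
    ∃ e K : ℕ → ℕ, e 0 = 0 ∧ K 0 = 0 ∧ (∀ k, e k + 2 ≤ e (k + 1)) ∧
      (∀ k, K (k + 1) = K k + (2 * (k + 2) * 3 ^ e k + 1)) ∧
      ∀ k, ∀ i < K (k + 1), 4 * (1 / 3 : ℝ) ^ e (k + 1) ≤ ε i := by
  have h : ∀ N : ℕ, ∃ E : ℕ, ∀ i < N, 4 * (1 / 3 : ℝ) ^ E ≤ ε i := by
    intro N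
    induction N with
    | zero => exact ⟨0, by simp⟩
    | succ N ih =>
      obtain ⟨E, hE⟩ := ih
      obtain ⟨E', hE'⟩ := exists_pow_lt_of_lt_one (by linarith [hε N] : 0 < ε N / 4)
        (by norm_num : (1 / 3 : ℝ) < 1)
      have hmono : ∀ p q : ℕ, p ≤ q → (1 / 3 : ℝ) ^ q ≤ (1 / 3) ^ p := fun p q hpq =>
        pow_le_pow_of_le_one (by norm_num) (by norm_num) hpq
      refine ⟨max E E', fun i hi => ?_⟩
      rcases Nat.lt_succ_iff_lt_or_eq.1 hi with h | rfl
      · linarith [hE i h, hmono _ _ (le_max_left E E')]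
      · linarith [hmono _ _ (le_max_right E E')]
  choose E hE using h
  let s : ℕ → ℕ × ℕ := fun n => Nat.rec (0, 0) (fun k p =>
    (p.1 + 2 + E (p.2 + (2 * (k + 2) * 3 ^ p.1 + 1)), p.2 + (2 * (k + 2) * 3 ^ p.1 + 1))) n
  refine ⟨fun k => (s k).1, fun k => (s k).2, rfl, rfl, fun k => Nat.le_add_right _ _,
    fun k => rfl, fun k i hi => le_trans ?_ (hE _ i hi)⟩
  refine mul_le_mul_of_nonneg_left ?_ (by norm_num)
  exact pow_le_pow_of_le_one (by norm_num) (by norm_num) (Nat.le_add_left _ _)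

/-- The points of a set `X` whose sum with a suitable meagre set is meagre are captured by
translated grids: in each of the blocks `[g n, g (n + 1))`, for all but finitely many `n`, some
grid `Y n + a k ℤ` comes close to a given point of `X`. -/
theorem exists_grids_near {X : Set ℝ} (hX : ∀ M : Set ℝ, IsMeagre M → IsMeagre (X + M))
    {e : ℕ → ℕ} (he0 : e 0 = 0) (he : ∀ k, e k + 2 ≤ e (k + 1)) :
    ∃ (g : ℕ → ℕ) (Y : ℕ → ℝ), g 0 = 0 ∧ StrictMono g ∧ (∀ n, Y n ∈ Icc 0 1) ∧
      ∀ x ∈ X, ∀ᶠ n in atTop, ∃ k, g n ≤ k ∧ k < g (n + 1) ∧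
        ∃ m : ℤ, |x - Y n - (1 / 3) ^ e k * m| < 2 * (1 / 3) ^ e (k + 1) := by
  obtain ⟨a, haE⟩ : ∃ a : ℕ → ℝ, ∀ k, a k = (1 / 3) ^ e k := ⟨_, fun _ => rfl⟩
  simp only [← haE]
  have hem : StrictMono e := strictMono_nat_of_lt_succ fun k => by linarith [he k]
  have ha : ∀ k, 0 < a k := fun k => by rw [haE]; positivity
  have haanti : Antitone a := fun p q hpq => by
    rw [haE, haE]
    exact pow_le_pow_of_le_one (by norm_num) (by norm_num) (hem.monotone hpq)
  have hah : ∀ k, a (k + 1) ≤ a k / 4 := fun k => by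
    have h : a (k + 1) ≤ (1 / 3) ^ (e k + 2) := by
      rw [haE]
      exact pow_le_pow_of_le_one (by norm_num) (by norm_num) (he k)
    rw [pow_add, ← haE] at h
    linarith [ha k]
  have hlim : Tendsto a atTop (𝓝 0) := by
    have := (tendsto_pow_atTop_nhds_zero_of_lt_one (r := (1 / 3 : ℝ)) (by norm_num)
      (by norm_num)).comp hem.tendsto_atTop
    exact this.congr fun k => (haE k).symm
  have hdiv : ∀ p q, p ≤ q → ∃ t : ℤ, a p = a q * (2 * t + 1) := by
    intro p q hpq
    obtain ⟨t, ht⟩ : Odd ((3 : ℤ) ^ (e q - e p)) := Odd.pow (by decide)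
    refine ⟨t, ?_⟩
    have h3 : (2 * t + 1 : ℝ) = 3 ^ (e q - e p) := by exact_mod_cast ht.symm
    have hs : e q = e p + (e q - e p) := by have := hem.monotone hpq; omega
    rw [h3, haE, haE]
    conv_rhs => rw [hs, pow_add]
    rw [Nat.add_sub_cancel_left, mul_assoc, ← mul_pow]
    norm_num
  have ha0 : a 0 = 1 := by rw [haE, he0, pow_zero]
  obtain ⟨G, hGm, hGc, hGn, hG⟩ :=
    (hX _ (isMeagre_eventually_far_from_grid ha hlim)).exists_monotone_isCompact
  have key : ∀ n k, ∃ k', k < k' ∧ ∃ y ∈ Icc 0 (a k), ∀ z ∈ G n, ∀ m : ℤ,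
      a k' < |z - y - a k * m| := by
    intro n k
    obtain ⟨y, hy, r, hr, h⟩ := exists_grid_avoiding (hGc n) (hGn n) (ha k)
    obtain ⟨k', hk', hkk'⟩ := ((hlim.eventually_lt_const hr).and (eventually_gt_atTop k)).exists
    exact ⟨k', hkk', y, hy, fun z hz m => hk'.trans (h z hz m)⟩
  choose k' hkk' y hy hyG using key
  let g : ℕ → ℕ := fun n => Nat.rec 0 k' n
  have hg : StrictMono g := strictMono_nat_of_lt_succ fun n => hkk' n (g n)
  have hYG : ∀ n, ∀ z ∈ G n, ∀ m : ℤ, a (g (n + 1)) < |z - y n (g n) - a (g n) * m| :=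
    fun n => hyG n (g n)
  refine ⟨g, fun n => y n (g n), rfl, hg, fun n => ?_, fun x hx => ?_⟩
  · exact ⟨(hy n (g n)).1, (hy n (g n)).2.trans ((haanti (Nat.zero_le _)).trans ha0.le)⟩
  by_contra hcon
  rw [not_eventually] at hcon
  push Not at hcon
  classical
  let P : ℕ → Prop := fun n => ∀ k, g n ≤ k → k < g (n + 1) → ∀ m : ℤ,
    2 * a (k + 1) ≤ |x - y n (g n) - a k * m|
  let c : ℕ → ℝ := fun n => if P n then y n (g n) - x else 1 / 2
  have hc : ∀ n k, g n ≤ k → k < g (n + 1) → ∀ m : ℤ, 2 * a (k + 1) ≤ |c n - a k * m| := by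
    intro n k h1 h2 m
    by_cases hP : P n
    · have h := hP k h1 h2 (-m)
      simp only [c, if_pos hP]
      rw [← abs_neg] at h
      convert h using 2
      push_cast
      ring
    · simp only [c, if_neg hP]
      obtain ⟨t, ht⟩ := hdiv 0 k (Nat.zero_le k)
      have e1 : (1 / 2 : ℝ) - a k * m = a k / 2 * ((2 * (t - m) + 1 : ℤ) : ℝ) := by
        rw [← ha0, ht]
        push_cast
        ring
      have h1 : (1 : ℝ) ≤ |((2 * (t - m) + 1 : ℤ) : ℝ)| := by
        rw [← Int.cast_abs]
        exact_mod_cast Int.one_le_abs (by omega)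
      rw [e1, abs_mul, abs_of_pos (half_pos (ha k))]
      nlinarith [hah k, ha k]
  obtain ⟨z, hz⟩ := exists_forall_near_grid (a := fun n => a (g n)) (fun n => ha _)
    (fun n => by
      have h1 := haanti (hg (Nat.lt_succ_self n) : g n + 1 ≤ g (n + 1))
      linarith [hah (g n), ha (g n)]) c
  have hzM : ∀ᶠ k in atTop, ∀ m : ℤ, a (k + 1) ≤ |z - a k * m| := by
    refine Eventually.of_forall fun k m => ?_
    obtain ⟨n, h1, h2⟩ := exists_mem_block (g := g) rfl hg k
    obtain ⟨p, hp⟩ := hz n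
    obtain ⟨t, ht⟩ := hdiv _ _ h1
    have h3 := hc n k h1 h2 (m - (2 * t + 1) * p)
    have h4 : a (g (n + 1)) ≤ a (k + 1) := haanti h2
    have e1 : c n - a k * ((m - (2 * t + 1) * p : ℤ) : ℝ)
        = (z - a k * m) - (z - c n - a (g n) * p) := by
      rw [ht]
      push_cast
      ring
    rw [e1] at h3
    have h5 := abs_sub (z - a k * m) (z - c n - a (g n) * p)
    linarith
  obtain ⟨N, hN⟩ := mem_iUnion.1 (hG (add_mem_add hx hzM))
  obtain ⟨n, hn, hnN⟩ := (hcon.and_eventually (eventually_ge_atTop N)).exists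
  obtain ⟨p, hp⟩ := hz n
  have h := hYG n _ (hGm hnN hN) p
  have hcn : c n = y n (g n) - x := if_pos hn
  rw [hcn] at hp
  refine h.not_ge (le_of_eq_of_le ?_ hp)
  congr 1
  ring

/-- A meager-additive set has sharp measure zero. -/
theorem isSSMZ_of_meagre_additive {X : Set ℝ}
    (hX : ∀ M : Set ℝ, IsMeagre M → IsMeagre (X + M)) : IsSSMZ X := by
  intro ε hε
  obtain ⟨e, K, he0, hK0, he, hK, hsmall⟩ := exists_scales hε
  obtain ⟨g, Y, hg0, hg, hY, hXg⟩ := exists_grids_near hX he0 he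
  have hKm : StrictMono K := strictMono_nat_of_lt_succ fun k => by rw [hK]; omega
  refine ⟨fun i => {x | ∃ k n, K k ≤ i ∧ i < K (k + 1) ∧ g n ≤ k ∧ k < g (n + 1) ∧
    |x - Y n - (1 / 3) ^ e k * (i - K k - (k + 2) * 3 ^ e k)| < 2 * (1 / 3) ^ e (k + 1)},
    ⟨fun j => K (g j), by simp only [hg0, hK0], hKm.comp hg, fun x hx => ?_⟩, fun i => ?_⟩
  · obtain ⟨N, hN⟩ := exists_nat_ge |x|
    filter_upwards [hXg x hx, eventually_ge_atTop N] with n ⟨k, h1, h2, m, hm⟩ hn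
    have hk : |x| ≤ k := hN.trans (by exact_mod_cast hn.trans ((hg.id_le n).trans h1))
    have hp1 : (1 / 3 : ℝ) ^ e (k + 1) ≤ 1 / 3 := by
      simpa using pow_le_pow_of_le_one (by norm_num : (0 : ℝ) ≤ 1 / 3) (by norm_num)
        (by linarith [he k] : 1 ≤ e (k + 1))
    have h3 : (1 / 3 : ℝ) ^ e k * 3 ^ e k = 1 := by rw [← mul_pow]; norm_num
    have hpos : (0 : ℝ) < 3 ^ e k := by positivity
    have hm2 : |(1 / 3 : ℝ) ^ e k * m| ≤ k + 2 := by
      rw [abs_lt] at hm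
      rw [abs_le] at hk ⊢
      constructor <;> linarith [(hY n).1, (hY n).2]
    have hm3 : |(m : ℝ)| ≤ (k + 2) * 3 ^ e k := by
      have : (m : ℝ) = (1 / 3 : ℝ) ^ e k * m * 3 ^ e k := by
        rw [mul_right_comm, h3, one_mul]
      rw [this, abs_mul, abs_of_pos hpos]
      gcongr
    have hm4 : |m| ≤ (k + 2) * 3 ^ e k := by exact_mod_cast hm3
    obtain ⟨h4, h5⟩ := abs_le.1 hm4
    obtain ⟨i, hi⟩ := Int.eq_ofNat_of_zero_le
      (by linarith : (0 : ℤ) ≤ m + (k + 2) * 3 ^ e k)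
    have hilt : i < 2 * (k + 2) * 3 ^ e k + 1 := by
      zify
      rw [← hi]
      linarith
    refine ⟨K k + i, ?_, ?_, k, n, by omega, by rw [hK]; omega, h1, h2, ?_⟩
    · have := hKm.monotone h1
      omega
    · have := hKm.monotone (Nat.succ_le_of_lt h2)
      rw [hK] at this
      omega
    · have hiR : (m : ℝ) + (k + 2) * 3 ^ e k = i := by exact_mod_cast hi
      push_cast
      rw [← hiR]
      convert hm using 3
      ring
  · refine Metric.ediam_le ?_
    rintro x ⟨k, n, h1, h2, h3, h4, hx⟩ y ⟨k', n', h1', h2', h3', h4', hy⟩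
    obtain rfl := block_unique hKm h1 h2 h1' h2'
    obtain rfl := block_unique hg h3 h4 h3' h4'
    rw [edist_dist, Real.dist_eq]
    refine ENNReal.ofReal_le_ofReal (le_trans ?_ (hsmall k i h2))
    rw [abs_lt] at hx hy
    rw [abs_le]
    constructor <;> linarith [hx.1, hx.2, hy.1, hy.2]

/-- A set `X ⊆ ℝ` is meager-additive iff it has sharp measure zero (Euclidean metric). -/
theorem stmt15 (X : Set ℝ) :
    (∀ M : Set ℝ, IsMeagre M → IsMeagre (X + M)) ↔ IsSSMZ X :=
  ⟨isSSMZ_of_meagre_additive, fun hX _ hM => hX.isMeagre_add hM⟩
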